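/- Let k ≥ 3 and let Π and Π' be symbols of rank k and defect 1 (elements of 𝕍_k^1). For a symbol Σ of rank k and defect 1, let S(Σ) ⊆ 𝕍_{k−1}^1 denote the set of shift-equivalence classes of β-pairs obtained from some shift-representative of Σ by decreasing a single entry by 1, the result being again a β-pair (i.e. the modified row still consists of distinct nonnegative integers). If S(Π) = S(Π'), then Π = Π'. -/

import Mathlib

namespace CSpaper

/-- The rank of a β-set: the sum of its elements minus `choose (card) 2`. -/
def bRank (B : Finset ℕ) : ℤ :=
  (∑ b ∈ B, (b : ℤ)) - (B.card.choose 2 : ℤ)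

/-- The `k`-th shift of a β-set: `{0,…,k-1} ∪ {b+k : b ∈ B}`. -/
def bShift (k : ℕ) (B : Finset ℕ) : Finset ℕ :=
  Finset.range k ∪ B.image (· + k)

/-- Shift-equivalence of β-sets. -/
def sEquiv (A B : Finset ℕ) : Prop :=
  ∃ k, bShift k A = B ∨ A = bShift k B

/-- A β-pair: an ordered pair of β-sets. -/
abbrev BPair := Finset ℕ × Finset ℕ

/-- The defect of a β-pair. -/
def pDefect (Λ : BPair) : ℤ := (Λ.1.card : ℤ) - (Λ.2.card : ℤ)

/-- The rank of a β-pair: `rk A + rk B + ⌊(d/2)²⌋`. -/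
def pRank (Λ : BPair) : ℤ := bRank Λ.1 + bRank Λ.2 + pDefect Λ ^ 2 / 4

/-- The `k`-th shift of a β-pair. -/
def pShift (k : ℕ) (Λ : BPair) : BPair := (bShift k Λ.1, bShift k Λ.2)

/-- Shift-equivalence of β-pairs: one is a shift of the other. -/
def pEquiv (Λ Ξ : BPair) : Prop := ∃ k, pShift k Λ = Ξ ∨ Λ = pShift k Ξ

/-- `Λ` is a representative of a symbol in `𝕍_N^d`. -/
def inV (N d : ℤ) (Λ : BPair) : Prop := pRank Λ = N ∧ pDefect Λ = d

/-- The `i`-th smallest element of a finite set of naturals (0-indexed). -/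
def nthEl (A : Finset ℕ) (i : ℕ) : ℕ := (A.sort (· ≤ ·)).getD i 0

/-- The operation `A ⊙ B = {a_1+b_1, a_2+b_2-1, …, a_s+b_s-(s-1)}` (0-indexed:
`a_i + b_i - i`). -/
def odot (A B : Finset ℕ) : Finset ℕ :=
  (Finset.range A.card).image fun i => nthEl A i + nthEl B i - i

/-- Dominance order `B ⊴ A`: every tail sum of `B` is at most the corresponding
tail sum of `A`. -/
def domLE (B A : Finset ℕ) : Prop :=
  ∀ k, ∑ i ∈ Finset.Ico k B.card, nthEl B i ≤ ∑ i ∈ Finset.Ico k A.card, nthEl A i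

/-- No two consecutive integers. -/
def noConsec (S : Finset ℕ) : Prop := ∀ x ∈ S, x + 1 ∉ S

/-- `{0,2,…,2k-2} ∪ {x+2k : x ∈ S}`. -/
def evShift (k : ℕ) (S : Finset ℕ) : Finset ℕ :=
  (Finset.range k).image (fun i => 2 * i) ∪ S.image (· + 2 * k)

/-- `{1,3,…,2k-1} ∪ {y+2k : y ∈ S}`. -/
def odShift (k : ℕ) (S : Finset ℕ) : Finset ℕ :=
  (Finset.range k).image (fun i => 2 * i + 1) ∪ S.image (· + 2 * k)

/-- The `k`-th shift in the 𝕐-family. -/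
def yShift (k : ℕ) (P : BPair) : BPair := (evShift k P.1, odShift k P.2)

/-- The `k`-th shift in the 𝕏-family. -/
def xShift (k : ℕ) (P : BPair) : BPair := (evShift k P.1, evShift k P.2)

/-- Shift-equivalence in the 𝕐-family. -/
def yEquiv (P Q : BPair) : Prop := ∃ k, yShift k P = Q ∨ P = yShift k Q

/-- Shift-equivalence in the 𝕏-family (unordered pairs, so swaps are allowed). -/
def xEquiv (P Q : BPair) : Prop :=
  ∃ k, xShift k P = Q ∨ xShift k P = Q.swap ∨ P = xShift k Q ∨ P.swap = xShift k Q

/-- Membership in `Ỹ_N`. -/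
def inYtilde (N : ℤ) (P : BPair) : Prop :=
  (∀ y ∈ P.2, 0 < y) ∧ Odd (P.1.card + P.2.card) ∧ noConsec P.1 ∧ noConsec P.2 ∧
    2 * ((∑ x ∈ P.1, (x : ℤ)) + ∑ y ∈ P.2, (y : ℤ)) =
      N + ((P.1.card + P.2.card : ℕ) : ℤ) * (((P.1.card + P.2.card : ℕ) : ℤ) - 1)

/-- The defect in the 𝕐-family: `|X| - |Y|`. -/
def yDefect (P : BPair) : ℤ := (P.1.card : ℤ) - (P.2.card : ℤ)

/-- Membership in `X̃_N`. -/
def inXtilde (N : ℤ) (P : BPair) : Prop :=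
  noConsec P.1 ∧ noConsec P.2 ∧
    2 * ((∑ x ∈ P.1, (x : ℤ)) + ∑ y ∈ P.2, (y : ℤ)) =
      N + (((P.1.card + P.2.card : ℕ) : ℤ) - 1) ^ 2 - 1

/-- The defect in the 𝕏-family: `||A| - |B||`. -/
def xDefect (P : BPair) : ℤ := |(P.1.card : ℤ) - (P.2.card : ℤ)|

/-- The map `Θ(A,B) = ({0, a_1+2, …, a_s+s+1}, {b_1+1, …, b_s+s})`. -/
def theta (Λ : BPair) : BPair :=
  (insert 0 ((Finset.range Λ.1.card).image fun i => nthEl Λ.1 i + i + 2),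
   (Finset.range Λ.2.card).image fun i => nthEl Λ.2 i + i + 1)

/-- The map `Θ'(A,B) = ({0, a_1+2, …, a_s+s+1}, {b_1, …, b_s+s-1})`. -/
def theta' (Λ : BPair) : BPair :=
  (insert 0 ((Finset.range Λ.1.card).image fun i => nthEl Λ.1 i + i + 2),
   (Finset.range Λ.2.card).image fun i => nthEl Λ.2 i + i)

/-- The map `Θ̄(A,B) = ({a_1, …, a_s+s-1}, {b_1, …, b_s+s-1})`. -/
def thetaBar (Λ : BPair) : BPair :=
  ((Finset.range Λ.1.card).image fun i => nthEl Λ.1 i + i,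
   (Finset.range Λ.2.card).image fun i => nthEl Λ.2 i + i)

/-- `ᵀΘ(A,B) = Θ(B,A)`. -/
def thetaT (Λ : BPair) : BPair := theta (Λ.2, Λ.1)

/-- `Π^d` for `d ≥ 1`: adjoin `{0,2,…,2d-4}` to the first row and add `2d-2`
to its entries. -/
def piPos (d : ℕ) (P : BPair) : BPair := (evShift (d - 1) P.1, P.2)

/-- `Π^d` for `d = -e ≤ -1`: adjoin `{1,3,…,2e+1}` to the second row and add
`2e+2` to its entries. -/
def piNeg (e : ℕ) (P : BPair) : BPair := (P.1, odShift (e + 1) P.2)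

/-- `Δ_B^t = Π^{2t+1} ∘ Θ'`. -/
def deltaB (t : ℕ) (Λ : BPair) : BPair := piPos (2 * t + 1) (theta' Λ)

/-- `Δ_C^t = Π^{4t+1} ∘ Θ`. -/
def deltaC (t : ℕ) (Λ : BPair) : BPair := piPos (4 * t + 1) (theta Λ)

/-- `Δ_{C'}^t = Π^{1-4t} ∘ ᵀΘ` (for `t ≥ 1`). -/
def deltaC' (t : ℕ) (Λ : BPair) : BPair := piNeg (4 * t - 1) (thetaT Λ)

/-- `Δ_D^t = Π^{4t} ∘ Θ'` (for `t ≥ 1`). -/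
def deltaD (t : ℕ) (Λ : BPair) : BPair := piPos (4 * t) (theta' Λ)

/-- `Δ_D^0 = Θ̄`. -/
def deltaD0 (Λ : BPair) : BPair := thetaBar Λ

/-- All entries of a pair (with multiplicity) in weakly increasing order. -/
def entries (P : BPair) : List ℕ := (P.1.val + P.2.val).sort (· ≤ ·)

/-- `Σ_j (len-1-j) ⬝ (L[j] - ref j)`, the common shape of `a`, `b` and `σ`. -/
def wsum (L : List ℕ) (ref : ℕ → ℕ) : ℤ :=
  ∑ j ∈ Finset.range L.length,
    ((L.length - 1 - j : ℕ) : ℤ) * ((L.getD j 0 : ℤ) - (ref j : ℤ))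

/-- Lusztig's a-function (reference sequence `0,0,1,1,…`). -/
def aFun (P : BPair) : ℤ := wsum (entries P) (fun j => j / 2)

/-- Lusztig's b-function with the 𝕏-reference sequence `0,0,2,2,…`. -/
def bX (P : BPair) : ℤ := wsum (entries P) (fun j => 2 * (j / 2))

/-- Lusztig's b-function with the 𝕐-reference sequence `0,1,2,…`. -/
def bY (P : BPair) : ℤ := wsum (entries P) (fun j => j)

/-- `σ(Λ) = Σ (2k-i)·x_i`. -/
def sigmaFun (P : BPair) : ℤ := wsum (entries P) (fun _ => 0)

/-- Entrywise sum of two rows (of equal size), sorted positions added. -/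
def addRows (X X' : Finset ℕ) : Finset ℕ :=
  (Finset.range X.card).image fun i => nthEl X i + nthEl X' i

/-- `Λ ⊕ Ξ` in the types B and D cases. -/
def oplus (Λ Ξ : BPair) : BPair := (addRows Λ.1 Ξ.1, addRows Λ.2 Ξ.2)

/-- `Λ ⊕ Ξ` in the type C case. -/
def oplusC (Λ Ξ : BPair) : BPair :=
  (insert (nthEl Ξ.1 0)
      ((Finset.range Λ.1.card).image fun i => nthEl Λ.1 i + nthEl Ξ.1 (i + 1) + 1),
   (Finset.range Λ.2.card).image fun j => nthEl Λ.2 j + nthEl Ξ.2 j + 1)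

/-- `Λ ⊞ Ξ`: the twisted combination in type D. -/
def boxplus (Λ Ξ : BPair) : BPair := (addRows Λ.2 Ξ.1, addRows Λ.1 Ξ.2)

/-- Similarity of β-pairs: after shifts, the row unions and row intersections
coincide. -/
def pSimilar (Λ Ξ : BPair) : Prop :=
  ∃ j k, (pShift j Λ).1 ∪ (pShift j Λ).2 = (pShift k Ξ).1 ∪ (pShift k Ξ).2 ∧
    (pShift j Λ).1 ∩ (pShift j Λ).2 = (pShift k Ξ).1 ∩ (pShift k Ξ).2

/-- Similarity in the 𝕏-family: after 𝕏-shifts, the row unions and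
intersections coincide. -/
def xSimilar (P Q : BPair) : Prop :=
  ∃ j k, (xShift j P).1 ∪ (xShift j P).2 = (xShift k Q).1 ∪ (xShift k Q).2 ∧
    (xShift j P).1 ∩ (xShift j P).2 = (xShift k Q).1 ∩ (xShift k Q).2

/-- A β-pair is reduced if it is not a proper shift, i.e. `0` does not lie in
both rows; each shift-equivalence class has a unique reduced representative. -/
def reduced (Λ : BPair) : Prop := ¬ (0 ∈ Λ.1 ∧ 0 ∈ Λ.2)

/-- `a(Λ) + a(Ξ) = b(Λ⊕Ξ)`, computed (as in the paper) on shift-representatives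
with matching row sizes. -/
def minimalPair (Λ Ξ : BPair) : Prop :=
  ∃ Λ' Ξ', pEquiv Λ Λ' ∧ pEquiv Ξ Ξ' ∧ Λ'.1.card = Ξ'.1.card ∧
    Λ'.2.card = Ξ'.2.card ∧ aFun Λ' + aFun Ξ' = bX (oplus Λ' Ξ')

/-- The generating relation `i ≈ i+1` whenever `c_i = c_{i+1}` or `d_i = d_{i+1}`. -/
def linkRel (n : ℕ) (c d : ℕ → ℕ) (i j : Fin n) : Prop :=
  (j : ℕ) = (i : ℕ) + 1 ∧ (c i = c j ∨ d i = d j)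

/-- The equivalence relation generated by `linkRel`. -/
def idxSetoid (n : ℕ) (c d : ℕ → ℕ) : Setoid (Fin n) :=
  ⟨Relation.EqvGen (linkRel n c d), Relation.EqvGen.is_equivalence _⟩

/-- A degenerate equivalence class: `{i, i+1}` with `c_i = c_{i+1}` and
`d_i = d_{i+1}`. -/
def degenClass (n : ℕ) (c d : ℕ → ℕ) (Q : Quotient (idxSetoid n c d)) : Prop :=
  ∃ i j : Fin n, (j : ℕ) = (i : ℕ) + 1 ∧ c i = c j ∧ d i = d j ∧
    Q = Quotient.mk (idxSetoid n c d) i ∧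
    ∀ m : Fin n, Quotient.mk (idxSetoid n c d) m = Q → m = i ∨ m = j

/-- The number `ℓ` of non-degenerate equivalence classes. -/
noncomputable def ellCount (n : ℕ) (c d : ℕ → ℕ) : ℕ :=
  Nat.card {Q : Quotient (idxSetoid n c d) // ¬ degenClass n c d Q}

/-- `Ξ` is obtained from `Λ` by decreasing a single entry by `1`, the result
again being a β-pair. -/
def stepDown (Λ Ξ : BPair) : Prop :=
  (∃ x ∈ Λ.1, 0 < x ∧ x - 1 ∉ Λ.1 ∧ Ξ = (insert (x - 1) (Λ.1.erase x), Λ.2)) ∨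
  (∃ x ∈ Λ.2, 0 < x ∧ x - 1 ∉ Λ.2 ∧ Ξ = (Λ.1, insert (x - 1) (Λ.2.erase x)))

section Shift

theorem mem_bShift {k x : ℕ} {B : Finset ℕ} :
    x ∈ bShift k B ↔ x < k ∨ (k ≤ x ∧ x - k ∈ B) := by
  simp only [bShift, Finset.mem_union, Finset.mem_range, Finset.mem_image]
  refine or_congr_right ⟨?_, fun h => ⟨x - k, h.2, by omega⟩⟩
  rintro ⟨b, hb, rfl⟩
  simpa using hb

theorem add_mem_bShift {k x : ℕ} {B : Finset ℕ} : x + k ∈ bShift k B ↔ x ∈ B := by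
  simp [mem_bShift]

theorem bShift_injective (k : ℕ) : Function.Injective (bShift k) := fun A B h => by
  ext x
  rw [← add_mem_bShift (k := k), h, add_mem_bShift]

theorem bShift_bShift (j k : ℕ) (B : Finset ℕ) : bShift j (bShift k B) = bShift (j + k) B := by
  ext x
  simp only [mem_bShift, Nat.sub_sub]
  by_cases h : x < j + k
  · simp only [h, true_or, iff_true]
    omega
  · have h1 : ¬ x < j := by omega
    have h2 : ¬ x - j < k := by omega
    have h3 : j ≤ x := by omega
    have h4 : k ≤ x - j := by omega
    have h5 : j + k ≤ x := by omega
    simp [h, h1, h2, h3, h4, h5]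

theorem bShift_insert (k x : ℕ) (B : Finset ℕ) :
    bShift k (insert x B) = insert (x + k) (bShift k B) := by
  simp [bShift, Finset.image_insert]

theorem bShift_empty (k : ℕ) : bShift k ∅ = Finset.range k := by
  simp [bShift]

theorem card_bShift (k : ℕ) (B : Finset ℕ) : (bShift k B).card = k + B.card := by
  induction B using Finset.induction_on with
  | empty => simp [bShift_empty]
  | insert x B hx ih =>
    rw [bShift_insert, Finset.card_insert_of_notMem (mt add_mem_bShift.1 hx),
      Finset.card_insert_of_notMem hx, ih, add_assoc]

theorem bRank_insert {x : ℕ} {B : Finset ℕ} (hx : x ∉ B) :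
    bRank (insert x B) = bRank B + x - B.card := by
  simp only [bRank, Finset.sum_insert hx, Finset.card_insert_of_notMem hx,
    Nat.choose_succ_succ' B.card 1, Nat.choose_one_right]
  push_cast
  ring

theorem bRank_range (n : ℕ) : bRank (Finset.range n) = 0 := by
  induction n with
  | zero => simp [bRank]
  | succ n ih => rw [Finset.range_add_one, bRank_insert (by simp), ih]; simp

theorem bRank_bShift (k : ℕ) (B : Finset ℕ) : bRank (bShift k B) = bRank B := by
  induction B using Finset.induction_on with
  | empty => rw [bShift_empty, bRank_range]; simp [bRank]
  | insert x B hx ih =>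
    rw [bShift_insert, bRank_insert (mt add_mem_bShift.1 hx), bRank_insert hx, ih, card_bShift]
    push_cast
    ring

theorem pShift_injective (k : ℕ) : Function.Injective (pShift k) := fun Λ Ξ h => by
  simp only [pShift, Prod.mk.injEq] at h
  exact Prod.ext (bShift_injective k h.1) (bShift_injective k h.2)

theorem pShift_pShift (j k : ℕ) (Λ : BPair) : pShift j (pShift k Λ) = pShift (j + k) Λ := by
  simp [pShift, bShift_bShift]

theorem pShift_zero (Λ : BPair) : pShift 0 Λ = Λ := by
  simp [pShift, bShift]

theorem pEquiv_iff {Λ Ξ : BPair} : pEquiv Λ Ξ ↔ ∃ m n, pShift m Λ = pShift n Ξ := by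
  constructor
  · rintro ⟨k, h | h⟩
    · exact ⟨k, 0, by rw [h, pShift_zero]⟩
    · exact ⟨0, k, by rw [h, pShift_zero]⟩
  · rintro ⟨m, n, h⟩
    rcases le_total m n with hmn | hmn
    · obtain ⟨c, rfl⟩ := Nat.exists_eq_add_of_le hmn
      rw [← pShift_pShift] at h
      exact ⟨c, .inr (pShift_injective m h)⟩
    · obtain ⟨c, rfl⟩ := Nat.exists_eq_add_of_le hmn
      rw [← pShift_pShift] at h
      exact ⟨c, .inl (pShift_injective n h)⟩

theorem pEquiv.refl (Λ : BPair) : pEquiv Λ Λ := ⟨0, .inl (pShift_zero Λ)⟩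

theorem pEquiv.symm {Λ Ξ : BPair} (h : pEquiv Λ Ξ) : pEquiv Ξ Λ := by
  obtain ⟨k, h⟩ := h
  exact ⟨k, h.symm.imp Eq.symm Eq.symm⟩

theorem pEquiv.trans {Λ Ξ Ω : BPair} (h₁ : pEquiv Λ Ξ) (h₂ : pEquiv Ξ Ω) : pEquiv Λ Ω := by
  rw [pEquiv_iff] at *
  obtain ⟨m, n, h₁⟩ := h₁
  obtain ⟨p, q, h₂⟩ := h₂
  refine ⟨p + m, n + q, ?_⟩
  rw [← pShift_pShift, h₁, pShift_pShift, add_comm p n, ← pShift_pShift, h₂, pShift_pShift]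

theorem pEquiv_pShift (k : ℕ) (Λ : BPair) : pEquiv Λ (pShift k Λ) := ⟨k, .inl rfl⟩

theorem pEquiv.eq_of_card {Λ Ξ : BPair} (h : pEquiv Λ Ξ) (hc : Λ.1.card = Ξ.1.card) : Λ = Ξ := by
  obtain ⟨k, rfl | rfl⟩ := h <;>
  · obtain rfl : k = 0 := by simpa [pShift, card_bShift] using hc
    rw [pShift_zero]

theorem pDefect_pShift (k : ℕ) (Λ : BPair) : pDefect (pShift k Λ) = pDefect Λ := by
  simp [pDefect, pShift, card_bShift]

theorem pRank_pShift (k : ℕ) (Λ : BPair) : pRank (pShift k Λ) = pRank Λ := by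
  rw [pRank, pRank, pDefect_pShift]
  simp [pShift, bRank_bShift]

end Shift

section Step

/-- The first row of `Λ` for `true`, the second row for `false`. -/
def row (Λ : BPair) (i : Bool) : Finset ℕ := cond i Λ.1 Λ.2

theorem row_ext {Λ Ξ : BPair} (h : ∀ i x, x ∈ row Λ i ↔ x ∈ row Ξ i) : Λ = Ξ :=
  Prod.ext (Finset.ext (h true)) (Finset.ext (h false))

theorem mem_row_pShift {k x : ℕ} {Λ : BPair} {i : Bool} :
    x ∈ row (pShift k Λ) i ↔ x < k ∨ (k ≤ x ∧ x - k ∈ row Λ i) := by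
  cases i <;> exact mem_bShift

/-- Replace the entry `x + 1` of row `i` by `x`. -/
def lower (Λ : BPair) (i : Bool) (x : ℕ) : BPair :=
  cond i (insert x (Λ.1.erase (x + 1)), Λ.2) (Λ.1, insert x (Λ.2.erase (x + 1)))

theorem mem_row_lower {Λ : BPair} {i j : Bool} {x y : ℕ} :
    y ∈ row (lower Λ i x) j ↔
      (j = i ∧ y = x) ∨ (y ∈ row Λ j ∧ ¬ (j = i ∧ y = x + 1)) := by
  cases i <;> cases j <;> simp [row, lower, and_comm]

theorem stepDown_iff {Λ Ξ : BPair} :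
    stepDown Λ Ξ ↔ ∃ i x, x + 1 ∈ row Λ i ∧ x ∉ row Λ i ∧ Ξ = lower Λ i x := by
  constructor
  · rintro (⟨x, hx, h0, hx', rfl⟩ | ⟨x, hx, h0, hx', rfl⟩)
    · obtain ⟨x, rfl⟩ := Nat.exists_eq_add_of_lt h0
      exact ⟨true, x, by simpa [row] using hx, by simpa [row] using hx', by simp [lower]⟩
    · obtain ⟨x, rfl⟩ := Nat.exists_eq_add_of_lt h0
      exact ⟨false, x, by simpa [row] using hx, by simpa [row] using hx', by simp [lower]⟩
  · rintro ⟨_ | _, x, hx, hx', rfl⟩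
    · exact .inr ⟨x + 1, hx, by simp, by simpa [row] using hx', by simp [lower]⟩
    · exact .inl ⟨x + 1, hx, by simp, by simpa [row] using hx', by simp [lower]⟩

theorem card_lower {Λ : BPair} {i : Bool} {x : ℕ} (hx : x + 1 ∈ row Λ i) (hx' : x ∉ row Λ i) :
    (lower Λ i x).1.card = Λ.1.card := by
  cases i
  · rfl
  · simp only [row, lower, cond_true] at *
    rw [Finset.card_insert_of_notMem (by simp [hx']), Finset.card_erase_add_one hx]

theorem stepDown.card {Λ Ξ : BPair} (h : stepDown Λ Ξ) : Ξ.1.card = Λ.1.card := by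
  obtain ⟨i, x, hx, hx', rfl⟩ := stepDown_iff.1 h
  exact card_lower hx hx'

theorem lower_pShift (k : ℕ) (Λ : BPair) (i : Bool) (x : ℕ) :
    lower (pShift k Λ) i (x + k) = pShift k (lower Λ i x) := by
  refine row_ext fun j y => ?_
  simp only [mem_row_lower, mem_row_pShift]
  grind

theorem stepDown_pShift {k : ℕ} {Λ Ξ : BPair} :
    stepDown (pShift k Λ) Ξ ↔ ∃ Ξ', stepDown Λ Ξ' ∧ Ξ = pShift k Ξ' := by
  simp only [stepDown_iff]
  constructor
  · rintro ⟨i, x, hx, hx', rfl⟩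
    rw [mem_row_pShift] at hx hx'
    push Not at hx'
    obtain ⟨x, rfl⟩ := Nat.exists_eq_add_of_le' hx'.1
    refine ⟨_, ⟨i, x, ?_, ?_, rfl⟩, lower_pShift ..⟩ <;> grind
  · rintro ⟨_, ⟨i, x, hx, hx', rfl⟩, rfl⟩
    refine ⟨i, x + k, ?_, ?_, (lower_pShift ..).symm⟩ <;> rw [mem_row_pShift] <;> grind

theorem stepDown.of_pEquiv {Λ Λ' Ξ : BPair} (h : pEquiv Λ Λ') (hs : stepDown Λ Ξ) :
    ∃ Ξ', stepDown Λ' Ξ' ∧ pEquiv Ξ Ξ' := by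
  obtain ⟨k, rfl | rfl⟩ := h
  · exact ⟨_, stepDown_pShift.2 ⟨Ξ, hs, rfl⟩, pEquiv_pShift k Ξ⟩
  · obtain ⟨Ξ', hs', rfl⟩ := stepDown_pShift.1 hs
    exact ⟨Ξ', hs', (pEquiv_pShift k Ξ').symm⟩

theorem stepDown_iff_exists_pEquiv {P Λ Ξ : BPair} (h : pEquiv P Λ)
    (hc : Ξ.1.card = Λ.1.card) :
    stepDown Λ Ξ ↔ ∃ Λ' Ξ', pEquiv P Λ' ∧ stepDown Λ' Ξ' ∧ pEquiv Ξ' Ξ := by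
  constructor
  · exact fun hs => ⟨Λ, Ξ, h, hs, .refl Ξ⟩
  · rintro ⟨Λ', Ξ', hP, hs, hΞ⟩
    obtain ⟨Ω, hΩ, hΞΩ⟩ := hs.of_pEquiv (hP.symm.trans h)
    rwa [← (hΞΩ.symm.trans hΞ).eq_of_card (by rw [hΩ.card, hc])]

end Step

section Rank

theorem bRank_eq_zero_of_closed {S : Finset ℕ} (h : ∀ y, y + 1 ∈ S → y ∈ S) : bRank S = 0 := by
  obtain ⟨n, rfl⟩ : ∃ n, S = Finset.range n := by
    rcases S.eq_empty_or_nonempty with rfl | hS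
    · exact ⟨0, rfl⟩
    · refine ⟨S.max' hS + 1, Finset.ext fun y => ?_⟩
      rw [Finset.mem_range, Nat.lt_succ_iff]
      refine ⟨S.le_max' y, fun hy => ?_⟩
      exact Nat.decreasingInduction (motive := fun z _ => z ∈ S) (fun z _ hz => h z hz)
        (S.max'_mem hS) hy
  exact bRank_range n

theorem pRank_eq_row {Λ : BPair} (hd : pDefect Λ = 1) (i : Bool) :
    pRank Λ = bRank (row Λ i) + bRank (row Λ !i) := by
  cases i <;> simp [pRank, hd, row, add_comm]

/-- If lowering `Λ` at `(i, x)` and `Λ'` at `(j, y)` gives the same pair, then either the pairs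
agree or `Λ'` arises from `Λ` by lowering at `(i, x)` and raising the entry `y` of row `j`. -/
theorem lower_eq_lower {Λ Λ' : BPair} (hne : Λ ≠ Λ') {i j : Bool} {x y : ℕ}
    (hx : x + 1 ∈ row Λ i) (hx' : x ∉ row Λ i) (hy : y + 1 ∈ row Λ' j) (hy' : y ∉ row Λ' j)
    (h : lower Λ i x = lower Λ' j y) :
    y ∈ row Λ j ∧ y + 1 ∉ row Λ j ∧ ¬ (j = i ∧ (y = x + 1 ∨ y + 1 = x)) ∧
      ∀ l z, z ∈ row Λ' l ↔ (z ∈ row Λ l ∧ ¬ (l = i ∧ z = x + 1) ∧ ¬ (l = j ∧ z = y)) ∨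
        (l = i ∧ z = x) ∨ (l = j ∧ z = y + 1) := by
  have key : ∀ l z, ((l = i ∧ z = x) ∨ (z ∈ row Λ l ∧ ¬ (l = i ∧ z = x + 1))) ↔
      ((l = j ∧ z = y) ∨ (z ∈ row Λ' l ∧ ¬ (l = j ∧ z = y + 1))) := fun l z => by
    rw [← mem_row_lower, h, mem_row_lower]
  have hij : ¬ (j = i ∧ y = x) := by
    rintro ⟨rfl, rfl⟩
    refine hne (row_ext fun l z => ?_)
    have := key l z
    grind
  have k1 := key i x
  have k2 := key i (x + 1)
  have k3 := key j y
  have k4 := key j (y + 1)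
  refine ⟨by grind, by grind, by grind, fun l z => ?_⟩
  have := key l z
  grind

theorem eq_of_stepDown_iff {Λ Λ' : BPair} (hd : pDefect Λ = 1) (hr : 3 ≤ pRank Λ)
    (hS : ∀ Ξ, stepDown Λ Ξ ↔ stepDown Λ' Ξ) : Λ = Λ' := by
  by_contra hne
  have hpartner : ∀ i x, x + 1 ∈ row Λ i → x ∉ row Λ i → ∃ j y, y + 1 ∈ row Λ' j ∧
      y ∉ row Λ' j ∧ lower Λ i x = lower Λ' j y := fun i x hx hx' =>
    stepDown_iff.1 ((hS _).1 (stepDown_iff.2 ⟨i, x, hx, hx', rfl⟩))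
  have hpartner' : ∀ j y, y + 1 ∈ row Λ' j → y ∉ row Λ' j → ∃ i x, x + 1 ∈ row Λ i ∧
      x ∉ row Λ i ∧ lower Λ' j y = lower Λ i x := fun j y hy hy' =>
    stepDown_iff.1 ((hS _).2 (stepDown_iff.2 ⟨j, y, hy, hy', rfl⟩))
  obtain ⟨i, x, hx, hx'⟩ : ∃ i x, x + 1 ∈ row Λ i ∧ x ∉ row Λ i := by
    by_contra! h
    rw [pRank_eq_row hd true, bRank_eq_zero_of_closed (h _), bRank_eq_zero_of_closed (h _)] at hr
    omega
  have huniq : ∀ l z, z + 1 ∈ row Λ l → z ∈ row Λ l ∨ (l = i ∧ z = x) := by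
    intro l z hz
    by_contra! hcon
    obtain ⟨j, y, hy, hy', he⟩ := hpartner i x hx hx'
    obtain ⟨m, w, hw, hw', he'⟩ := hpartner l z hz hcon.1
    obtain ⟨a1, a2, a3, a4⟩ := lower_eq_lower hne hx hx' hy hy' he
    obtain ⟨b1, b2, b3, b4⟩ := lower_eq_lower hne hz hcon.1 hw hw' he'
    have c1 := a4 i x
    have c2 := b4 i x
    have c3 := a4 i (x + 1)
    have c4 := b4 i (x + 1)
    have c5 := a4 l z
    have c6 := a4 l (z + 1)
    grind
  obtain ⟨j, y, hy, hy', he⟩ := hpartner i x hx hx'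
  have huniq' : ∀ l z, z + 1 ∈ row Λ' l → z ∈ row Λ' l ∨ (l = j ∧ z = y) := by
    intro l z hz
    by_contra! hcon
    obtain ⟨m, w, hw, hw', he'⟩ := hpartner' l z hz hcon.1
    obtain ⟨rfl, rfl⟩ : m = i ∧ w = x := by grind
    have := congrArg (fun Ω => z + 1 ∈ row Ω l) (he.symm.trans he'.symm)
    simp only [mem_row_lower] at this
    grind
  obtain ⟨a1, a2, a3, a4⟩ := lower_eq_lower hne hx hx' hy hy' he
  have hother : bRank (row Λ !i) = 0 := by
    refine bRank_eq_zero_of_closed fun z hz => (huniq _ z hz).resolve_right ?_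
    cases i <;> simp
  rw [pRank_eq_row hd i, hother, add_zero] at hr
  have hdown : ∀ m ∈ row Λ i, m ≤ x → ∀ z ≤ m, z ∈ row Λ i := by
    intro m hm hmx z hz
    refine Nat.decreasingInduction' (P := fun z => z ∈ row Λ i) (fun w hw _ hw' => ?_) hz hm
    exact (huniq i w hw').resolve_right (by omega)
  have hup : ∀ m, x < m → m ∉ row Λ i → ∀ z, m ≤ z → z ∉ row Λ i := by
    intro m hm hm' z hz
    induction z, hz using Nat.le_induction with
    | base => exact hm'
    | succ w hw ih => exact fun h => ((huniq i w h).resolve_left ih).2.not_gt (by omega)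
  have hlt : ∀ m ≤ x, (∀ w, w + 1 = m → w ∈ row Λ i) → ∀ z < m, z ∈ row Λ i := by
    intro m hm h z hz
    obtain ⟨w, rfl⟩ := Nat.exists_eq_add_of_lt hz
    exact hdown _ (h _ rfl) (by omega) z (by omega)
  have hpred : ∀ w, w + 1 = x → w ∈ row Λ' i ∨ (i = j ∧ w = y) := by
    rintro w rfl
    exact huniq' i w (by grind)
  by_cases hx2 : x + 2 ∈ row Λ i
  · obtain ⟨rfl, rfl⟩ : j = i ∧ y = x + 2 := by
      have c1 := a4 i (x + 2)
      have c2 := a4 i (x + 1)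
      have c3 := huniq' i (x + 1)
      grind
    have hb := hlt x le_rfl fun w hw => by
      have := a4 j w
      grind
    have hR : row Λ j = insert (x + 2) (insert (x + 1) (Finset.range x)) := by
      ext z
      have := hup (x + 3) (by omega) a2 z
      have := hb z
      simp only [Finset.mem_insert, Finset.mem_range]
      grind
    rw [hR, bRank_insert (by simp), bRank_insert (by simp), bRank_range,
      Finset.card_insert_of_notMem (by simp), Finset.card_range] at hr
    push_cast at hr
    omega
  have hbig := hup (x + 2) (by omega) hx2
  by_cases hji : j = i
  · subst hji
    have hyx : y < x := by
      by_contra! hcon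
      have := hbig y
      grind
    obtain rfl : x = y + 2 := by
      obtain ⟨w, rfl⟩ := Nat.exists_eq_add_of_lt hyx
      have c1 := hpred (y + w) rfl
      have c2 := a4 j (y + w)
      have c3 := fun h => hdown (y + w) h (by omega) (y + 1)
      grind
    have hR : row Λ j = insert (y + 3) (Finset.range (y + 1)) := by
      ext z
      have := hbig z
      have := hdown y a1 (by omega) z
      have := fun h h' => hdown z h h' (y + 1)
      simp only [Finset.mem_insert, Finset.mem_range]
      grind
    rw [hR, bRank_insert (by simp), bRank_range, Finset.card_range] at hr
    push_cast at hr
    omega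
  · have hb := hlt x le_rfl fun w hw => by
      have := a4 i w
      grind
    have hR : row Λ i = insert (x + 1) (Finset.range x) := by
      ext z
      have := hbig z
      have := hb z
      simp only [Finset.mem_insert, Finset.mem_range]
      grind
    rw [hR, bRank_insert (by simp), bRank_range, Finset.card_range] at hr
    push_cast at hr
    omega

end Rank

/-- for `k ≥ 3`, two symbols of rank `k` and defect `1` with the
same set `S(-)` of classes obtained by decreasing a single entry by one are
equal (shift-equivalent). -/
theorem statement_19 (k : ℕ) (hk : 3 ≤ k) (P P' : BPair)
    (hr : pRank P = k) (hd : pDefect P = 1)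
    (hr' : pRank P' = k) (hd' : pDefect P' = 1)
    (hS : ∀ Ξ : BPair,
      (∃ Λ Ξ', pEquiv P Λ ∧ stepDown Λ Ξ' ∧ pEquiv Ξ' Ξ) ↔
      (∃ Λ Ξ', pEquiv P' Λ ∧ stepDown Λ Ξ' ∧ pEquiv Ξ' Ξ)) :
    pEquiv P P' := by
  have hc : (pShift P'.1.card P).1.card = (pShift P.1.card P').1.card := by
    simp [pShift, card_bShift, add_comm]
  have h := pEquiv_pShift P'.1.card P
  have h' := pEquiv_pShift P.1.card P'
  have heq : pShift P'.1.card P = pShift P.1.card P' := by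
    refine eq_of_stepDown_iff ((pDefect_pShift _ P).trans hd)
      (by rw [pRank_pShift, hr]; exact_mod_cast hk) fun Ξ => ?_
    by_cases hΞ : Ξ.1.card = (pShift P'.1.card P).1.card
    · rw [stepDown_iff_exists_pEquiv h hΞ, stepDown_iff_exists_pEquiv h' (hΞ.trans hc), hS]
    · exact iff_of_false (fun hs => hΞ hs.card) (fun hs => hΞ (hs.card.trans hc.symm))
  exact h.trans (heq ▸ h'.symm)

end CSpaper
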